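/- Let α = ι ⊕ κ, β, γ be finite index types, P an invertible complex matrix indexed by (α⊕β)×(α⊕β), Q an invertible complex matrix indexed by (α⊕γ)×(α⊕γ), J a complex matrix indexed by ι×ι, and D'' a complex matrix indexed by κ×κ. Set D_B := I_ι ⊕ D'' and B := P⁻¹·fromBlocks(D_B,O,O,O)·Q⁻¹. Write Q_ι for the ι-columns of Q, Q_s for the γ-columns of Q, P_ι for the ι-rows of P, P_s for the β-rows of P, Π_Q := I − Q_s(Q_sᴴQ_s)⁻¹Q_sᴴ, Π_P := I − P_sᴴ(P_sP_sᴴ)⁻¹P_s, Q̂_Ω := Π_Q Q_ι, P̂_Ω := P_ι Π_P, and M_k := Q̂_Ω J^k P̂_Ω for k ∈ ℕ. Then for every k ∈ ℕ, P · B · M_k = fromBlocks(I_α, O, O, O) · Q⁻¹ · M_k. -/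

import Mathlib

open Matrix

/-- Multiplying selected columns of an invertible matrix by `F * Q⁻¹` selects columns of `F`. -/
lemma mul_inv_mul_submatrix_id {m n p R : Type*} [Fintype n] [DecidableEq n] [CommRing R]
    {Q : Matrix n n R} (hQ : IsUnit Q) (F : Matrix m n R) (f : p → n) :
    F * Q⁻¹ * Q.submatrix id f = F.submatrix id f := by
  have hdet : IsUnit Q.det := (Matrix.isUnit_iff_isUnit_det Q).mp hQ
  calc F * Q⁻¹ * Q.submatrix id f = (F * Q⁻¹ * Q).submatrix id f := rfl
    _ = F.submatrix id f := by rw [Matrix.nonsing_inv_mul_cancel_right Q F hdet]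

/-- If `F` vanishes on the columns `g`, then `F * Q⁻¹` sends `Q_f`, corrected by a combination of
the columns `Q_g`, to the columns `f` of `F`. -/
lemma mul_inv_mul_one_sub_mul_submatrix {m n p q R : Type*} [Fintype n] [DecidableEq n]
    [Fintype q] [CommRing R] {Q : Matrix n n R} (hQ : IsUnit Q) {F : Matrix m n R} (f : p → n)
    {g : q → n} (hF : F.submatrix id g = 0) (X : Matrix q n R) :
    F * Q⁻¹ * ((1 - Q.submatrix id g * X) * Q.submatrix id f) = F.submatrix id f := by
  rw [← Matrix.mul_assoc, Matrix.mul_sub, Matrix.mul_one, ← Matrix.mul_assoc,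
    mul_inv_mul_submatrix_id hQ, hF, Matrix.zero_mul, sub_zero, mul_inv_mul_submatrix_id hQ]

/-- With `α = ι ⊕ κ`, `B = P⁻¹ · fromBlocks(I_ι ⊕ D'', O, O, O) · Q⁻¹` and complex
moments `M_k = Q̂_Ω J^k P̂_Ω`, one has `P B M_k = fromBlocks(I_α, O, O, O) · Q⁻¹ · M_k`
for every `k`. -/
theorem pencil_B_moment_fixed {ι κ β γ : Type} [Fintype ι] [Fintype κ] [Fintype β]
    [Fintype γ] [DecidableEq ι] [DecidableEq κ] [DecidableEq β] [DecidableEq γ]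
    (P : Matrix ((ι ⊕ κ) ⊕ β) ((ι ⊕ κ) ⊕ β) ℂ) (hP : IsUnit P)
    (Q : Matrix ((ι ⊕ κ) ⊕ γ) ((ι ⊕ κ) ⊕ γ) ℂ) (hQ : IsUnit Q)
    (J : Matrix ι ι ℂ) (D'' : Matrix κ κ ℂ) :
    let B : Matrix ((ι ⊕ κ) ⊕ β) ((ι ⊕ κ) ⊕ γ) ℂ :=
      P⁻¹ * (Matrix.fromBlocks (Matrix.fromBlocks (1 : Matrix ι ι ℂ) 0 0 D'') 0 0 0 :
        Matrix ((ι ⊕ κ) ⊕ β) ((ι ⊕ κ) ⊕ γ) ℂ) * Q⁻¹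
    let Qι := Q.submatrix (id : (ι ⊕ κ) ⊕ γ → (ι ⊕ κ) ⊕ γ) (Sum.inl ∘ Sum.inl)
    let Qs := Q.submatrix (id : (ι ⊕ κ) ⊕ γ → (ι ⊕ κ) ⊕ γ) Sum.inr
    let Pι := P.submatrix (Sum.inl ∘ Sum.inl) (id : (ι ⊕ κ) ⊕ β → (ι ⊕ κ) ⊕ β)
    let Ps := P.submatrix Sum.inr (id : (ι ⊕ κ) ⊕ β → (ι ⊕ κ) ⊕ β)
    let QhatΩ := ((1 : Matrix ((ι ⊕ κ) ⊕ γ) ((ι ⊕ κ) ⊕ γ) ℂ) - Qs * (Qsᴴ * Qs)⁻¹ * Qsᴴ) * Qι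
    let PhatΩ := Pι * ((1 : Matrix ((ι ⊕ κ) ⊕ β) ((ι ⊕ κ) ⊕ β) ℂ) - Psᴴ * (Ps * Psᴴ)⁻¹ * Ps)
    let Mk : ℕ → Matrix ((ι ⊕ κ) ⊕ γ) ((ι ⊕ κ) ⊕ β) ℂ := fun k => QhatΩ * J ^ k * PhatΩ
    ∀ k : ℕ,
      P * B * Mk k =
        (Matrix.fromBlocks (1 : Matrix (ι ⊕ κ) (ι ⊕ κ) ℂ) 0 0 0 :
          Matrix ((ι ⊕ κ) ⊕ β) ((ι ⊕ κ) ⊕ γ) ℂ) * Q⁻¹ * Mk k := by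
  intro B Qι Qs Pι Ps QhatΩ PhatΩ Mk k
  have hdet : IsUnit P.det := (Matrix.isUnit_iff_isUnit_det P).mp hP
  have hcol (D : Matrix (ι ⊕ κ) (ι ⊕ κ) ℂ) :
      (Matrix.fromBlocks D 0 0 0 : Matrix ((ι ⊕ κ) ⊕ β) ((ι ⊕ κ) ⊕ γ) ℂ) * Q⁻¹ * QhatΩ =
        (Matrix.fromBlocks D 0 0 0 : Matrix ((ι ⊕ κ) ⊕ β) ((ι ⊕ κ) ⊕ γ) ℂ).submatrix id
          (Sum.inl ∘ Sum.inl) := by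
    simp only [QhatΩ, Matrix.mul_assoc Qs]
    refine mul_inv_mul_one_sub_mul_submatrix hQ _ ?_ _
    ext (i | i) j <;> rfl
  have hPB : P * B = (Matrix.fromBlocks (Matrix.fromBlocks 1 0 0 D'') 0 0 0 :
      Matrix ((ι ⊕ κ) ⊕ β) ((ι ⊕ κ) ⊕ γ) ℂ) * Q⁻¹ := by
    simp only [B, Matrix.mul_assoc, Matrix.mul_nonsing_inv_cancel_left P _ hdet]
  have hMk (D : Matrix (ι ⊕ κ) (ι ⊕ κ) ℂ) :
      (Matrix.fromBlocks D 0 0 0 : Matrix ((ι ⊕ κ) ⊕ β) ((ι ⊕ κ) ⊕ γ) ℂ) * Q⁻¹ * Mk k =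
        (Matrix.fromBlocks D 0 0 0 : Matrix ((ι ⊕ κ) ⊕ β) ((ι ⊕ κ) ⊕ γ) ℂ).submatrix id
          (Sum.inl ∘ Sum.inl) * (J ^ k * PhatΩ) := by
    rw [← hcol D, Matrix.mul_assoc _ QhatΩ, ← Matrix.mul_assoc QhatΩ]
  rw [hPB, hMk, hMk]
  congr 1
  ext ((i | i) | i) j <;> simp [Matrix.one_apply]
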